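/- (On trees, every optimal allocation is a Nash equilibrium.) Let G be a finite tree (a connected acyclic simple graph) on a vertex set V of n players and let O be a finite set of resources. If P° is an optimal allocation, i.e., C(P°) ≤ C(Q) for every allocation Q : V → O, then P° is a pure Nash equilibrium of the CSR game on G. -/

import Mathlib

open Finset

noncomputable section

variable {V O : Type*} [Fintype V] [DecidableEq V] [Fintype O] [DecidableEq O]

/-- Diameter of the graph: maximum graph distance between any two vertices. -/
def csrDiam (G : SimpleGraph V) : ℕ :=
  Finset.sup Finset.univ fun i => Finset.sup Finset.univ fun j => G.dist i j

/-- Distance from player `i` to the nearest holder of resource `o` under allocation `P`;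
`csrDiam G + 1` if no one holds `o`. -/
def csrDist (G : SimpleGraph V) (P : V → O) (i : V) (o : O) : ℕ :=
  if h : (Finset.univ.filter fun j => P j = o).Nonempty then
    (Finset.univ.filter fun j => P j = o).inf' h fun j => G.dist i j
  else csrDiam G + 1

/-- Cost of player `i` under allocation `P`. -/
def csrCost (G : SimpleGraph V) (P : V → O) (i : V) : ℕ :=
  ∑ o ∈ Finset.univ.filter (fun o => o ≠ P i), csrDist G P i o

/-- Total cost of allocation `P`. -/
def csrTotal (G : SimpleGraph V) (P : V → O) : ℕ := ∑ i, csrCost G P i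

/-- Radius of player `i`: distance to nearest *other* player holding the same resource;
`csrDiam G` if there is none. -/
def csrRadius (G : SimpleGraph V) (P : V → O) (i : V) : ℕ :=
  if h : (Finset.univ.filter fun j => j ≠ i ∧ P j = P i).Nonempty then
    (Finset.univ.filter fun j => j ≠ i ∧ P j = P i).inf' h fun j => G.dist i j
  else csrDiam G

/-- Ball of radius `r` (a natural number) around `i`. -/
def csrBall (G : SimpleGraph V) (i : V) (r : ℕ) : Finset V :=
  Finset.univ.filter fun j => G.dist i j ≤ r

/-- Pure Nash equilibrium of the CSR game. -/
def csrIsNE (G : SimpleGraph V) (P : V → O) : Prop :=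
  ∀ (i : V) (o : O), csrCost G P i ≤ csrCost G (Function.update P i o) i

theorem aux_bip (G : SimpleGraph V) (hT : G.IsTree) (k k' x : V) (h : G.Adj k k') :
    G.dist x k = G.dist x k' + 1 ∨ G.dist x k' = G.dist x k + 1 := by
  have h1 := hT.dist_ne_of_adj x h
  have h2 := hT.connected.dist_triangle (u := x) (v := k) (w := k')
  have h3 := hT.connected.dist_triangle (u := x) (v := k') (w := k)
  have h4 : G.dist k k' = 1 := SimpleGraph.dist_eq_one_iff_adj.2 h
  have h5 : G.dist k' k = 1 := SimpleGraph.dist_eq_one_iff_adj.2 h.symm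
  omega

theorem aux_geo (G : SimpleGraph V) {u v : V} (p : G.Walk u v) (hp : p.length = G.dist u v)
    (w : V) (hw : w ∈ p.support) : G.dist u w + G.dist w v ≤ G.dist u v := by
  have h1 := congrArg SimpleGraph.Walk.length (p.take_spec hw)
  rw [SimpleGraph.Walk.length_append] at h1
  have h2 := SimpleGraph.dist_le (p.takeUntil w hw)
  have h3 := SimpleGraph.dist_le (p.dropUntil w hw)
  omega

theorem aux_cross (G : SimpleGraph V) (hT : G.IsTree) (k k' x y : V) (h : G.Adj k k')
    (hx : G.dist x k' = G.dist x k + 1) (hy : G.dist y k = G.dist y k' + 1) :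
    G.dist x y = G.dist x k + 1 + G.dist k' y := by
  have hc := hT.connected
  obtain ⟨p, hp⟩ := hc.exists_walk_length_eq_dist x k
  obtain ⟨q, hq⟩ := hc.exists_walk_length_eq_dist k' y
  have hpp := p.isPath_of_length_eq_dist hp
  have hqp := q.isPath_of_length_eq_dist hq
  have hpath : (p.append (SimpleGraph.Walk.cons h q)).IsPath := by
    rw [SimpleGraph.Walk.isPath_def, SimpleGraph.Walk.support_append, SimpleGraph.Walk.support_cons,
      List.tail_cons, List.nodup_append']
    refine ⟨hpp.support_nodup, hqp.support_nodup, ?_⟩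
    intro w hw hw'
    have a1 := aux_geo G p hp w hw
    have a2 := aux_geo G q hq w hw'
    have a3 := hc.dist_triangle (u := x) (v := w) (w := k')
    have a4 := hc.dist_triangle (u := k) (v := w) (w := y)
    have := G.dist_comm (u := y) (v := k)
    have := G.dist_comm (u := y) (v := k')
    have := G.dist_comm (u := w) (v := k)
    have := G.dist_comm (u := w) (v := k')
    omega
  obtain ⟨r, hr⟩ := hc.exists_walk_length_eq_dist x y
  have hrp := r.isPath_of_length_eq_dist hr
  have := (hT.isAcyclic.subsingleton_path x y).elim ⟨_, hrp⟩ ⟨_, hpath⟩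
  have h2 : r = _ := congrArg Subtype.val this
  rw [← hr, h2, SimpleGraph.Walk.length_append, SimpleGraph.Walk.length_cons, hp, hq]
  omega

theorem aux_parent (G : SimpleGraph V) (hc : G.Connected) (ρ k' : V) (hne : k' ≠ ρ) :
    ∃ k, G.Adj k k' ∧ G.dist ρ k' = G.dist ρ k + 1 := by
  obtain ⟨p, hp⟩ := hc.exists_walk_length_eq_dist k' ρ
  cases p with
  | nil => exact absurd rfl hne
  | @cons _ k _ h q =>
    refine ⟨k, h.symm, ?_⟩
    rw [SimpleGraph.Walk.length_cons] at hp
    have h1 := SimpleGraph.dist_le q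
    have h2 := hc.dist_triangle (u := k') (v := k) (w := ρ)
    have h4 : G.dist k' k = 1 := SimpleGraph.dist_eq_one_iff_adj.2 h
    have := G.dist_comm (u := ρ) (v := k)
    have := G.dist_comm (u := ρ) (v := k')
    omega

theorem aux_col (G : SimpleGraph V) (hT : G.IsTree) (S : Finset V) (hS : 1 < S.card) :
    ∃ (f : V → Bool), ∀ k, ∃ a ∈ S, ∃ b ∈ S, f a ≠ f b ∧ (∀ s ∈ S, G.dist k a ≤ G.dist k s) ∧
      (∀ s ∈ S, s ≠ a → G.dist k b ≤ G.dist k s) := by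
  classical
  have hc := hT.connected
  set N := Fintype.card V with hN
  let e : V → ℕ := fun v => (Fintype.equivFin V v : ℕ)
  have he : ∀ v, e v < N := fun v => (Fintype.equivFin V v).2
  have hei : ∀ v w, e v = e w → v = w := fun v w h =>
    (Fintype.equivFin V).injective (Fin.ext h)
  obtain ⟨key, hkey⟩ : ∃ key : V → V → ℕ, ∀ k s, key k s = G.dist k s * N + e s := ⟨_, fun _ _ => rfl⟩
  have hinj : ∀ k s t, key k s = key k t → s = t := by
    intro k s t h
    rw [hkey, hkey] at h
    apply hei
    have := congrArg (· % N) h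
    simpa [Nat.add_mod, Nat.mod_eq_of_lt (he _)] using this
  have hdist : ∀ k s t, key k s ≤ key k t → G.dist k s ≤ G.dist k t := by
    intro k s t h
    rw [hkey, hkey] at h
    by_contra! hlt
    have := Nat.mul_le_mul_right N (Nat.succ_le_of_lt hlt)
    have := he t
    rw [Nat.succ_mul] at *
    omega
  have hmove : ∀ k k' c s, G.dist k c = G.dist k k' + G.dist k' c → key k' s < key k' c →
      key k s < key k c := by
    intro k k' c s h hlt
    rw [hkey, hkey] at *
    have := Nat.mul_le_mul_right N (hc.dist_triangle (u := k) (v := k') (w := s))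
    rw [h]
    rw [Nat.add_mul] at *
    omega
  have hex : ∀ k, ∃ a b, a ∈ S ∧ b ∈ S ∧ a ≠ b ∧ (∀ s ∈ S, key k a ≤ key k s) ∧
      (∀ s ∈ S, s ≠ a → key k b ≤ key k s) := by
    intro k
    obtain ⟨a, ha, ha'⟩ := S.exists_min_image (key k) (Finset.card_pos.1 (by omega))
    obtain ⟨b, hb, hb'⟩ := (S.erase a).exists_min_image (key k)
      (Finset.card_pos.1 (by rw [Finset.card_erase_of_mem ha]; omega))
    rw [Finset.mem_erase] at hb
    exact ⟨a, b, ha, hb.2, hb.1.symm, ha', fun s hs hsa => hb' s (Finset.mem_erase.2 ⟨hsa, hs⟩)⟩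
  choose a b ha hb hab hmin hmin2 using hex
  have hstar : ∀ k k' c, G.dist k c = G.dist k k' + G.dist k' c → (c = a k ∨ c = b k) →
      (c = a k' ∨ c = b k') := by
    intro k k' c h hck
    by_contra! hcon
    obtain ⟨h1, h2⟩ := hcon
    have hcS : c ∈ S := by rcases hck with h | h <;> rw [h]; exacts [ha k, hb k]
    have l1 : key k' (a k') < key k' c :=
      lt_of_le_of_ne (hmin _ _ hcS) (fun h => h1 (hinj _ _ _ h).symm)
    have l2 : key k' (b k') < key k' c :=
      lt_of_le_of_ne (hmin2 _ _ hcS h1) (fun h => h2 (hinj _ _ _ h).symm)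
    have m1 := hmove _ _ _ _ h l1
    have m2 := hmove _ _ _ _ h l2
    rcases hck with rfl | rfl
    · exact absurd (hmin k _ (ha k')) (by omega)
    · apply hab k'
      have e1 : a k' = a k := by
        by_contra hh
        have := hmin2 k _ (ha k') hh
        omega
      have e2 : b k' = a k := by
        by_contra hh
        have := hmin2 k _ (hb k') hh
        omega
      rw [e1, e2]
  obtain ⟨ρ⟩ := hc.nonempty
  have key_ind : ∀ m, m + 1 ≤ Fintype.card V → ∃ U : Finset V, U.card = m + 1 ∧ ρ ∈ U ∧
      (∀ u ∈ U, ∀ w, G.dist ρ u = G.dist ρ w + G.dist w u → w ∈ U) ∧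
      ∃ f : V → Bool, ∀ u ∈ U, f (a u) ≠ f (b u) := by
    intro m
    induction m with
    | zero =>
      intro _
      refine ⟨{ρ}, by simp, by simp, ?_, fun v => decide (v = a ρ), ?_⟩
      · intro u hu w hw
        rw [Finset.mem_singleton] at hu
        subst hu
        rw [SimpleGraph.dist_self] at hw
        have : G.dist u w = 0 := by omega
        simp [(hc.dist_eq_zero_iff.1 this).symm]
      · intro u hu
        rw [Finset.mem_singleton] at hu
        subst hu
        simp [(hab u).symm]
    | succ m ih =>
      intro hm
      obtain ⟨U, hU, hρ, hconv, f, hf⟩ := ih (by omega)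
      obtain ⟨k', hk', hk'min⟩ := (Uᶜ).exists_min_image (G.dist ρ)
        (Finset.card_pos.1 (by rw [Finset.card_compl]; omega))
      rw [Finset.mem_compl] at hk'
      obtain ⟨k, hadj, hd⟩ := aux_parent G hc ρ k' (fun h => hk' (h ▸ hρ))
      have hkU : k ∈ U := by
        by_contra hh
        have := hk'min k (Finset.mem_compl.2 hh)
        omega
      have hkk : G.dist k' k = 1 := SimpleGraph.dist_eq_one_iff_adj.2 hadj.symm
      have hold : ∀ c u, u ∈ U → (c = a k' ∨ c = b k') → (c = a u ∨ c = b u) →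
          (c = a k ∨ c = b k) := by
        intro c u hu h1 h2
        rcases aux_bip G hT k k' c hadj with h | h
        · rcases aux_bip G hT k k' u hadj with h' | h'
          · exfalso
            apply hk'
            apply hconv u hu
            have := aux_cross G hT k k' ρ u hadj hd h'
            omega
          · refine hstar u k c ?_ h2
            have := aux_cross G hT k k' u c hadj h' h
            rw [G.dist_comm (u := c), G.dist_comm (u := c)] at h
            omega
        · refine hstar k' k c ?_ h1
          rw [G.dist_comm (u := c), G.dist_comm (u := c)] at h
          omega
      refine ⟨insert k' U, by rw [Finset.card_insert_of_notMem hk', hU],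
        Finset.mem_insert_of_mem hρ, ?_, ?_⟩
      · intro u hu w hw
        rw [Finset.mem_insert] at hu ⊢
        rcases hu with rfl | hu
        · by_contra! hh
          have := hk'min w (Finset.mem_compl.2 hh.2)
          have h0 : G.dist w u = 0 := by omega
          exact hh.1 (hc.dist_eq_zero_iff.1 h0)
        · exact Or.inr (hconv u hu w hw)
      · have hfk := hf k hkU
        have hext : ∀ c d, (c = a k' ∨ c = b k') → c ≠ d → ¬ (c = a k ∨ c = b k) →
            ∃ g : V → Bool, g c ≠ g d ∧ ∀ u ∈ U, g (a u) ≠ g (b u) := by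
          intro c d h1 hcd h2
          refine ⟨Function.update f c (! f d), ?_, ?_⟩
          · simp [Function.update_of_ne hcd.symm]
          · intro u hu
            have h3 : ¬ (c = a u ∨ c = b u) := fun h => h2 (hold c u hu h1 h)
            push Not at h3
            rw [Function.update_of_ne h3.1.symm, Function.update_of_ne h3.2.symm]
            exact hf u hu
        by_cases hA : a k' = a k ∨ a k' = b k
        · by_cases hB : b k' = a k ∨ b k' = b k
          · refine ⟨f, ?_⟩
            intro u hu
            rcases Finset.mem_insert.1 hu with rfl | hu
            · have := hab u
              rcases hA with h | h <;> rcases hB with h' | h' <;> rw [h, h'] at this ⊢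
              · exact absurd rfl this
              · exact hfk
              · exact hfk.symm
              · exact absurd rfl this
            · exact hf u hu
          · obtain ⟨g, hg, hg'⟩ := hext (b k') (a k') (Or.inr rfl) (hab k').symm hB
            refine ⟨g, fun u hu => ?_⟩
            rcases Finset.mem_insert.1 hu with rfl | hu
            exacts [hg.symm, hg' u hu]
        · obtain ⟨g, hg, hg'⟩ := hext (a k') (b k') (Or.inl rfl) (hab k') hA
          refine ⟨g, fun u hu => ?_⟩
          rcases Finset.mem_insert.1 hu with rfl | hu
          exacts [hg, hg' u hu]
  have hpos : 0 < Fintype.card V := Fintype.card_pos_iff.2 ⟨ρ⟩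
  obtain ⟨U, hU, -, -, f, hf⟩ := key_ind (Fintype.card V - 1) (by omega)
  have hUu : U = Finset.univ := Finset.eq_univ_of_card U (by omega)
  refine ⟨f, fun k => ⟨a k, ha k, b k, hb k, hf k (hUu ▸ Finset.mem_univ k), ?_, ?_⟩⟩
  · exact fun s hs => hdist _ _ _ (hmin k s hs)
  · exact fun s hs hsa => hdist _ _ _ (hmin2 k s hs hsa)

theorem aux_le (G : SimpleGraph V) (P : V → O) (k x : V) (o : O) (h : P x = o) :
    csrDist G P k o ≤ G.dist k x := by
  have hx : x ∈ Finset.univ.filter fun j => P j = o := by simp [h]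
  unfold csrDist
  rw [dif_pos ⟨x, hx⟩]
  exact Finset.inf'_le _ hx

theorem aux_diam (G : SimpleGraph V) (i j : V) : G.dist i j ≤ csrDiam G := by
  unfold csrDiam
  exact le_trans (Finset.le_sup (f := fun j => G.dist i j) (Finset.mem_univ j))
    (Finset.le_sup (f := fun i => Finset.univ.sup fun j => G.dist i j) (Finset.mem_univ i))

theorem aux_cases (G : SimpleGraph V) (P : V → O) (k : V) (o : O) :
    (∃ x, P x = o ∧ csrDist G P k o = G.dist k x) ∨ csrDist G P k o = csrDiam G + 1 := by
  unfold csrDist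
  split_ifs with h
  · left
    obtain ⟨x, hx, hx'⟩ := Finset.exists_mem_eq_inf' h (fun j => G.dist k j)
    exact ⟨x, by simpa using hx, hx'⟩
  · right; rfl

theorem aux_dle (G : SimpleGraph V) (P : V → O) (k : V) (o : O) :
    csrDist G P k o ≤ csrDiam G + 1 := by
  rcases aux_cases G P k o with ⟨x, _, h⟩ | h
  · have := aux_diam G k x
    omega
  · omega

theorem aux_congr (G : SimpleGraph V) (P Q : V → O) (k : V) (o : O)
    (h : ∀ x, P x = o ↔ Q x = o) : csrDist G P k o = csrDist G Q k o := by
  unfold csrDist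
  simp only [h]

theorem aux_cost (G : SimpleGraph V) (P : V → O) (k : V) :
    csrCost G P k = ∑ o, csrDist G P k o := by
  unfold csrCost
  apply Finset.sum_subset (Finset.filter_subset _ _)
  intro o _ ho
  have ho' : P k = o := by
    by_contra hh
    exact ho (by simp [Ne.symm hh])
  have := aux_le G P k k o ho'
  rw [SimpleGraph.dist_self] at this
  omega

theorem aux_split (g : O → ℕ) (o q : O) (h : o ≠ q) :
    ∑ x, g x = g o + g q + ∑ x ∈ (Finset.univ.erase o).erase q, g x := by
  rw [← Finset.add_sum_erase Finset.univ g (Finset.mem_univ o),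
    ← Finset.add_sum_erase (Finset.univ.erase o) g (a := q) (by simp [h.symm])]
  omega

theorem stmt16 (G : SimpleGraph V) (hconn : G.Connected) (hacyc : G.IsAcyclic)
    (Po : V → O) (hopt : ∀ Q : V → O, csrTotal G Po ≤ csrTotal G Q) :
    csrIsNE G Po := by
  classical
  have hT : G.IsTree := ⟨hconn, hacyc⟩
  intro i q
  by_contra! hlt
  have hne : Po i ≠ q := by
    rintro rfl
    rw [Function.update_eq_self] at hlt
    omega
  obtain ⟨o, ho⟩ : ∃ o, Po i = o := ⟨_, rfl⟩
  rw [ho] at hne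
  have hi0 : csrDist G Po i o = 0 := by
    have := aux_le G Po i i o ho
    rw [SimpleGraph.dist_self] at this
    omega
  have hlt2 : csrDist G (Function.update Po i q) i o < csrDist G Po i q := by
    rw [aux_cost, aux_cost, aux_split _ o q hne, aux_split _ o q hne] at hlt
    have hs : ∑ x ∈ (Finset.univ.erase o).erase q, csrDist G (Function.update Po i q) i x =
        ∑ x ∈ (Finset.univ.erase o).erase q, csrDist G Po i x := by
      apply Finset.sum_congr rfl
      intro x hx
      simp only [Finset.mem_erase, Finset.mem_univ, and_true] at hx
      apply aux_congr
      intro v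
      by_cases hv : v = i
      · subst hv
        rw [Function.update_self, ho]
        exact ⟨fun h => absurd h.symm hx.1, fun h => absurd h.symm hx.2⟩
      · rw [Function.update_of_ne hv]
    omega
  obtain ⟨j, hj, hjd⟩ : ∃ j, Function.update Po i q j = o ∧
      csrDist G (Function.update Po i q) i o = G.dist i j := by
    rcases aux_cases G (Function.update Po i q) i o with h | h
    · exact h
    · have := aux_dle G Po i q
      omega
  have hji : j ≠ i := by
    rintro rfl
    rw [Function.update_self] at hj
    exact hne hj.symm
  rw [Function.update_of_ne hji] at hj
  obtain ⟨S, hS⟩ : ∃ S : Finset V, ∀ x, x ∈ S ↔ (Po x = o ∨ Po x = q) :=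
    ⟨Finset.univ.filter fun x => Po x = o ∨ Po x = q, by simp⟩
  obtain ⟨f, hf⟩ := aux_col G hT S
    (Finset.one_lt_card.2 ⟨j, (hS j).2 (Or.inl hj), i, (hS i).2 (Or.inl ho), hji⟩)
  obtain ⟨Q, hQ⟩ : ∃ Q : V → O, ∀ x, Q x = if x ∈ S then (if f x then o else q) else Po x :=
    ⟨_, fun _ => rfl⟩
  have hub : ∀ k a b, a ∈ S → b ∈ S → f a ≠ f b →
      csrDist G Q k o + csrDist G Q k q ≤ G.dist k a + G.dist k b := by
    intro k a b ha hb hab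
    have qa := hQ a
    have qb := hQ b
    rw [if_pos ha] at qa
    rw [if_pos hb] at qb
    cases hfa : f a <;> cases hfb : f b <;> simp [hfa, hfb] at qa qb hab
    · have := aux_le G Q k a q qa
      have := aux_le G Q k b o qb
      omega
    · have := aux_le G Q k a o qa
      have := aux_le G Q k b q qb
      omega
  have hother : ∀ k, ∑ x ∈ (Finset.univ.erase o).erase q, csrDist G Q k x =
        ∑ x ∈ (Finset.univ.erase o).erase q, csrDist G Po k x := by
    intro k
    apply Finset.sum_congr rfl
    intro x hx
    simp only [Finset.mem_erase, Finset.mem_univ, and_true] at hx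
    apply aux_congr
    intro v
    have qv := hQ v
    by_cases hv : v ∈ S
    · rw [if_pos hv] at qv
      have := (hS v).1 hv
      grind
    · rw [if_neg hv] at qv
      rw [qv]
  have hcost : csrTotal G Q < csrTotal G Po := by
    unfold csrTotal
    apply Finset.sum_lt_sum
    · intro k _
      rw [aux_cost, aux_cost, aux_split _ o q hne, aux_split _ o q hne, hother]
      obtain ⟨a, ha, b, hb, hab, h1, h2⟩ := hf k
      have hu := hub k a b ha hb hab
      have da := aux_diam G k a
      have db := aux_diam G k b
      have hkey : G.dist k a + G.dist k b ≤ csrDist G Po k o + csrDist G Po k q := by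
        have hab' := h1 b hb
        rcases aux_cases G Po k o with ⟨x, hx, hxd⟩ | hx
        · have hxS := (hS x).2 (Or.inl hx)
          have := h1 x hxS
          rcases aux_cases G Po k q with ⟨y, hy, hyd⟩ | hy
          · have hyS := (hS y).2 (Or.inr hy)
            have := h1 y hyS
            by_cases hxa : x = a
            · have := h2 y hyS (by rintro rfl; rw [hxa] at hx; exact hne (hx.symm.trans hy))
              omega
            · have := h2 x hxS hxa
              omega
          · omega
        · have := aux_le G Po k i o ho
          have := aux_diam G k i
          omega
      omega
    · refine ⟨i, Finset.mem_univ i, ?_⟩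
      rw [aux_cost, aux_cost, aux_split _ o q hne, aux_split _ o q hne, hother]
      obtain ⟨a, ha, b, hb, hab, h1, h2⟩ := hf i
      have hu := hub i a b ha hb hab
      have h3 := h1 i ((hS i).2 (Or.inl ho))
      rw [SimpleGraph.dist_self] at h3
      have h0 : G.dist i a = 0 := by omega
      have hia : i = a := hconn.dist_eq_zero_iff.1 h0
      have := h2 j ((hS j).2 (Or.inl hj)) (hia ▸ hji)
      omega
  exact absurd (hopt Q) (by omega)
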